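/- arXiv:1806.00714 — 3 statements merged into one kernel-verified Lean document; each statement's English description precedes it below -/
import Mathlib

section
/- In the ring K[[z]] of formal power series in z over the field K = ℚ(t, w) of rational functions in two indeterminates, the following identity holds: (1 + z/w) · Σ_{n≥1} n · zⁿ w^{−n} · Q_n(w) · P_n(z)^{−1} = t·z. Here the n-th summand, viewed in K[[z]], has z-adic order at least n (since P_n(z)^{−1} is a power series in z with constant term 1/n!), so the infinite sum converges z-adically; the identity states that the sum telescopes to tz. -/
/-!
STATEMENT 1: in `K[[z]]` with `K = ℚ(t,w)`,
`(1 + z/w) · Σ_{n≥1} n zⁿ w^{−n} Q_n(w) P_n(z)^{−1} = t z`.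

The `n`-th summand has `z`-adic order at least `n`, so the sum is the power
series whose coefficient of `z^a` is the finite sum
`Σ_{1 ≤ n ≤ a} n w^{−n} Q_n(w) · [z^{a−n}] (P_n(z)^{−1})`.
-/

noncomputable section

abbrev K₁ : Type := FractionRing (MvPolynomial (Fin 2) ℚ)

def tv : K₁ := algebraMap (MvPolynomial (Fin 2) ℚ) K₁ (MvPolynomial.X 0)
def wv : K₁ := algebraMap (MvPolynomial (Fin 2) ℚ) K₁ (MvPolynomial.X 1)

/-- `P n = (1+tz)_n = ∏_{j=1}^n (tz + j)`, as a power series in `z` over `K₁`. -/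
def P (n : ℕ) : PowerSeries K₁ :=
  ∏ j ∈ Finset.range n,
    (PowerSeries.C tv * PowerSeries.X + PowerSeries.C ((j : K₁) + 1))

/-- `Q n = ∏_{j=0}^{n-1} (tw − j) ∈ K₁`, so that `(1+tw)_{−n} = (Q n)⁻¹`. -/
def Q (n : ℕ) : K₁ := ∏ j ∈ Finset.range n, (tv * wv - (j : K₁))

/-- The series `Σ_{n≥1} n zⁿ w^{−n} Q_n(w) P_n(z)^{−1} ∈ K₁[[z]]`, defined via its
coefficients: the summand of index `n` contributes to `[z^a]` only for `n ≤ a`. -/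
def Ssum : PowerSeries K₁ :=
  PowerSeries.mk fun a =>
    ∑ n ∈ Finset.Icc 1 a,
      (n : K₁) * wv ^ (-(n : ℤ)) * Q n * PowerSeries.coeff (a - n) (P n)⁻¹

open PowerSeries in
/-- The partial sum `Σ_{n≤N} n zⁿ w^{−n} Q_n(w) P_n(z)^{−1}`. -/
def partialSum (N : ℕ) : PowerSeries K₁ :=
  ∑ n ∈ Finset.range (N + 1), X ^ n * C ((n : K₁) * wv ^ (-(n : ℤ)) * Q n) * (P n)⁻¹

lemma wv_ne_zero : wv ≠ 0 := by
  unfold wv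
  rw [Ne, FaithfulSMul.algebraMap_eq_zero_iff]
  exact MvPolynomial.X_ne_zero 1

lemma P_succ (n : ℕ) : P (n + 1) =
    P n * (PowerSeries.C tv * PowerSeries.X + PowerSeries.C ((n : K₁) + 1)) :=
  Finset.prod_range_succ _ n

lemma Q_succ (n : ℕ) : Q (n + 1) = Q n * (tv * wv - (n : K₁)) :=
  Finset.prod_range_succ _ n

/-- The factor `tz + (n + 1)` cancels from `P_{n+1}(z)^{−1}`. -/
lemma P_inv_eq (n : ℕ) : (P n)⁻¹ =
    (PowerSeries.C tv * PowerSeries.X + PowerSeries.C ((n : K₁) + 1)) * (P (n + 1))⁻¹ := by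
  have h : PowerSeries.constantCoeff
      (PowerSeries.C tv * PowerSeries.X + PowerSeries.C ((n : K₁) + 1)) ≠ 0 := by
    simpa using Nat.cast_add_one_ne_zero n
  rw [P_succ, PowerSeries.mul_inv_rev, ← mul_assoc, PowerSeries.mul_inv_cancel _ h, one_mul]

open PowerSeries in
lemma one_add_mul_partialSum (N : ℕ) :
    (1 + X * C wv⁻¹) * partialSum N =
      C tv * X - X ^ (N + 1) * (C (wv ^ (-((N + 1 : ℕ) : ℤ)) * Q (N + 1)) * (P N)⁻¹) := by
  induction N with
  | zero =>
    have h : wv⁻¹ * (tv * wv) = tv := by field_simp [wv_ne_zero]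
    simp [partialSum, P, Q, -map_mul, h, mul_comm]
  | succ N ih =>
    have hpow : wv ^ (-((N + 1 + 1 : ℕ) : ℤ)) = wv ^ (-((N + 1 : ℕ) : ℤ)) * wv⁻¹ := by
      rw [← zpow_sub_one₀ wv_ne_zero]
      congr 1
    have hw : C wv * C wv⁻¹ = (1 : PowerSeries K₁) := by
      rw [← map_mul, mul_inv_cancel₀ wv_ne_zero, map_one]
    rw [partialSum, Finset.sum_range_succ, mul_add]
    rw [partialSum] at ih
    rw [ih, P_inv_eq N, Q_succ (N + 1), hpow]
    push_cast
    simp only [map_mul, map_sub, map_add, map_one]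
    linear_combination (-X ^ (N + 2) * C (wv ^ (-((N : ℤ) + 1))) * C (Q (N + 1)) *
      (P (N + 1))⁻¹ * C tv) * (-hw)

open PowerSeries in
lemma X_pow_dvd_Ssum_sub_partialSum (N : ℕ) :
    (X : PowerSeries K₁) ^ (N + 1) ∣ Ssum - partialSum N := by
  rw [X_pow_dvd_iff]
  intro a ha
  rw [map_sub, sub_eq_zero, Ssum, coeff_mk, partialSum, map_sum]
  simp only [mul_assoc (X ^ _), coeff_X_pow_mul', coeff_C_mul]
  rw [← Finset.sum_filter]
  refine Finset.sum_subset (fun n hn => ?_) (fun n hn hn' => ?_)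
  · simp only [Finset.mem_Icc, Finset.mem_filter, Finset.mem_range] at *
    omega
  · have : n = 0 := by
      simp only [Finset.mem_Icc, Finset.mem_filter, Finset.mem_range] at *
      omega
    simp [this]

/-- `(1 + z/w) · Σ_{n≥1} n zⁿ w^{−n} Q_n(w) P_n(z)^{−1} = t·z` in `K₁[[z]]`. -/
theorem telescoping_sum :
    (1 + PowerSeries.X * PowerSeries.C wv⁻¹) * Ssum
      = PowerSeries.C tv * PowerSeries.X := by
  rw [← sub_eq_zero]
  ext a
  have h : (PowerSeries.X : PowerSeries K₁) ^ (a + 1) ∣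
      (1 + PowerSeries.X * PowerSeries.C wv⁻¹) * Ssum - PowerSeries.C tv * PowerSeries.X := by
    have key : (1 + PowerSeries.X * PowerSeries.C wv⁻¹) * Ssum - PowerSeries.C tv * PowerSeries.X
        = (1 + PowerSeries.X * PowerSeries.C wv⁻¹) * (Ssum - partialSum a) -
          PowerSeries.X ^ (a + 1) *
            (PowerSeries.C (wv ^ (-((a + 1 : ℕ) : ℤ)) * Q (a + 1)) * (P a)⁻¹) := by
      linear_combination one_add_mul_partialSum a
    rw [key]
    exact dvd_sub ((X_pow_dvd_Ssum_sub_partialSum a).mul_left _) (dvd_mul_right _ _)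
  simpa using PowerSeries.X_pow_dvd_iff.mp h a a.lt_succ_self

end
end

section
/- Let K = ℚ(θ, y) be the field of rational functions in two indeterminates θ, y. There exists a unique formal power series w ∈ K[[x]] with constant term y satisfying the equation w · exp(w − y) = y · exp(−x/θ) in K[[x]] (here w − y lies in x·K[[x]], so exp(w − y) is a well-defined power series, and exp(−x/θ) = Σ_k (−x/θ)^k/k!). Moreover its expansion begins w = y − x·y/(θ(y+1)) + x²·y/(2θ²(y+1)³) + x³·y(2y−1)/(6θ³(y+1)⁵) + O(x⁴). -/
/-!
STATEMENT 5: the formal Lambert-function solution of the constraint equation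
`w · e^{w−y} = y · e^{−x/θ}` in `K[[x]]` with `K = ℚ(θ, y)`, together with the
beginning of its expansion.
-/

noncomputable section

abbrev K₅ : Type := FractionRing (MvPolynomial (Fin 2) ℚ)

def θv : K₅ := algebraMap (MvPolynomial (Fin 2) ℚ) K₅ (MvPolynomial.X 0)
def yv : K₅ := algebraMap (MvPolynomial (Fin 2) ℚ) K₅ (MvPolynomial.X 1)

/-- Exponential of a formal power series: for `f` with zero constant term,
`exp f = Σ_k f^k / k!`; the coefficient of `x^m` receives contributions only
from `k ≤ m`, so it is given by the finite sum below. -/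
def expS {L : Type*} [Field L] [CharZero L] (f : PowerSeries L) : PowerSeries L :=
  PowerSeries.mk fun m =>
    ∑ k ∈ Finset.range (m + 1), ((k.factorial : L))⁻¹ * PowerSeries.coeff m (f ^ k)

namespace PowerSeries

variable {L : Type*} [Field L]

/-- An operator on power series is nonexpansive if the first `n` coefficients of its value
depend only on the first `n` coefficients of its argument. -/
def Nonexpansive (H : L⟦X⟧ → L⟦X⟧) : Prop :=
  ∀ (n : ℕ) (f g : L⟦X⟧), X ^ n ∣ f - g → X ^ n ∣ H f - H g

theorem X_pow_dvd_sub_iff {n : ℕ} {f g : L⟦X⟧} :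
    X ^ n ∣ f - g ↔ ∀ m < n, coeff m f = coeff m g := by
  simp [X_pow_dvd_iff, sub_eq_zero]

theorem nonexpansive_C_mul (c : L) : Nonexpansive fun f : L⟦X⟧ => C c * f := by
  intro n f g h
  rw [← mul_sub]
  exact h.mul_left _

theorem Nonexpansive.mul {H K : L⟦X⟧ → L⟦X⟧} (hH : Nonexpansive H) (hK : Nonexpansive K) :
    Nonexpansive fun f => H f * K f := by
  intro n f g h
  have : H f * K f - H g * K g = H f * (K f - K g) + (H f - H g) * K g := by ring
  rw [this]
  exact dvd_add ((hK n f g h).mul_left _) ((hH n f g h).mul_right _)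

theorem nonexpansive_inv_one_add : Nonexpansive fun f : L⟦X⟧ => (1 + f)⁻¹ := by
  rintro (_ | n) f g h
  · simp
  have h₀ : constantCoeff (1 + f) = constantCoeff (1 + g) := by
    simpa using X_pow_dvd_sub_iff.1 h 0 n.succ_pos
  by_cases hf : constantCoeff (1 + f) = 0
  · simp [PowerSeries.inv_eq_zero.2 hf, PowerSeries.inv_eq_zero.2 (h₀ ▸ hf)]
  have hf' := PowerSeries.mul_inv_cancel _ hf
  have hg' := PowerSeries.mul_inv_cancel _ (h₀ ▸ hf)
  have : (1 + f)⁻¹ - (1 + g)⁻¹ = (f - g) * (-(1 + f)⁻¹ * (1 + g)⁻¹) := by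
    linear_combination (1 + g)⁻¹ * hf' - (1 + f)⁻¹ * hg'
  rw [this]
  exact h.mul_right _

theorem nonexpansive_lambert (c : L) : Nonexpansive fun w : L⟦X⟧ => C c * w * (1 + w)⁻¹ :=
  (nonexpansive_C_mul c).mul nonexpansive_inv_one_add

variable [CharZero L]

theorem X_pow_succ_dvd_sub_of_derivative {n : ℕ} {f g : L⟦X⟧}
    (h₀ : constantCoeff f = constantCoeff g) (h : X ^ n ∣ derivative L f - derivative L g) :
    X ^ (n + 1) ∣ f - g := by
  rw [X_pow_dvd_sub_iff] at h ⊢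
  rintro (_ | m) hm
  · simpa using h₀
  · have := h m (by omega)
    rw [coeff_derivative, coeff_derivative] at this
    exact mul_right_cancel₀ (Nat.cast_add_one_ne_zero m) this

theorem Nonexpansive.eq_of_derivative_eq {H : L⟦X⟧ → L⟦X⟧} (hH : Nonexpansive H) {f g : L⟦X⟧}
    (h₀ : constantCoeff f = constantCoeff g)
    (hf : derivative L f = H f) (hg : derivative L g = H g) : f = g := by
  have key : ∀ n, X ^ n ∣ f - g := by
    intro n
    induction n with
    | zero => simp
    | succ n ih =>
      apply X_pow_succ_dvd_sub_of_derivative h₀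
      rw [hf, hg]
      exact hH n f g ih
  ext n
  exact X_pow_dvd_sub_iff.1 (key (n + 1)) n n.lt_succ_self

theorem exists_derivative_eq (a : L) (f : L⟦X⟧) :
    ∃ F : L⟦X⟧, constantCoeff F = a ∧ derivative L F = f := by
  refine ⟨C a + X * mk fun n => coeff n f / (n + 1), by simp, ?_⟩
  ext n
  have : (n + 1 : L) ≠ 0 := Nat.cast_add_one_ne_zero n
  rw [coeff_derivative, map_add, coeff_succ_X_mul, coeff_mk, coeff_C]
  simp [this]

theorem Nonexpansive.exists_derivative_eq {H : L⟦X⟧ → L⟦X⟧} (hH : Nonexpansive H) (a : L) :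
    ∃ f : L⟦X⟧, constantCoeff f = a ∧ derivative L f = H f := by
  choose J hJ₀ hJ using fun f : L⟦X⟧ => PowerSeries.exists_derivative_eq a f
  let s : ℕ → L⟦X⟧ := fun n => (fun f => J (H f))^[n] 0
  have hs : ∀ n, s (n + 1) = J (H (s n)) := fun n => Function.iterate_succ_apply' _ _ _
  have step : ∀ n, X ^ n ∣ s (n + 1) - s n := by
    intro n
    induction n with
    | zero => simp
    | succ n ih =>
      have ih' := hH n _ _ ih
      rw [hs (n + 1), hs n]
      rw [hs n] at ih'
      apply X_pow_succ_dvd_sub_of_derivative (by rw [hJ₀, hJ₀])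
      rw [hJ, hJ]
      exact ih'
  have stable : ∀ n k, X ^ n ∣ s (n + k) - s n := by
    intro n k
    induction k with
    | zero => simp
    | succ k ih =>
      rw [← sub_add_sub_cancel _ (s (n + k))]
      exact dvd_add ((pow_dvd_pow X (by omega)).trans (step (n + k))) ih
  let w : L⟦X⟧ := mk fun n => coeff n (s (n + 1))
  have hw : ∀ n, X ^ n ∣ w - s n := by
    intro n
    rw [X_pow_dvd_sub_iff]
    intro m hm
    obtain ⟨k, rfl⟩ := Nat.exists_eq_add_of_lt hm
    rw [coeff_mk, add_right_comm]
    exact (X_pow_dvd_sub_iff.1 (stable (m + 1) k) m m.lt_succ_self).symm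
  have hfix : w = J (H w) := by
    ext n
    refine X_pow_dvd_sub_iff.1 ?_ n n.lt_succ_self
    rw [← sub_add_sub_cancel _ (s (n + 1))]
    refine dvd_add (hw (n + 1)) ?_
    rw [hs]
    apply X_pow_succ_dvd_sub_of_derivative (by rw [hJ₀, hJ₀])
    rw [hJ, hJ, dvd_sub_comm]
    exact hH n _ _ (hw n)
  exact ⟨w, by rw [hfix, hJ₀], by conv_lhs => rw [hfix, hJ]⟩

theorem coeff_expS_of_le {f : L⟦X⟧} (hf : constantCoeff f = 0) {m N : ℕ} (h : m ≤ N) :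
    coeff m (expS f) =
      coeff m (∑ k ∈ Finset.range (N + 1), C ((k.factorial : L))⁻¹ * f ^ k) := by
  rw [expS, coeff_mk, map_sum]
  simp only [coeff_C_mul]
  refine Finset.sum_subset (Finset.range_subset_range.2 (by omega)) fun k _ hk => ?_
  rw [Finset.mem_range, not_lt] at hk
  rw [X_pow_dvd_iff.1 (pow_dvd_pow_of_dvd (X_dvd_iff.2 hf) k) m (by omega), mul_zero]

theorem constantCoeff_expS (f : L⟦X⟧) : constantCoeff (expS f) = 1 := by
  rw [← coeff_zero_eq_constantCoeff_apply, expS, coeff_mk]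
  simp

theorem derivative_expS {f : L⟦X⟧} (hf : constantCoeff f = 0) :
    derivative L (expS f) = derivative L f * expS f := by
  have hsum : ∀ m, derivative L (∑ k ∈ Finset.range (m + 2), C ((k.factorial : L))⁻¹ * f ^ k) =
      derivative L f * ∑ k ∈ Finset.range (m + 1), C ((k.factorial : L))⁻¹ * f ^ k := by
    intro m
    rw [Finset.sum_range_succ', map_add, map_sum, Finset.mul_sum]
    simp only [pow_zero, mul_one, derivative_C, add_zero]
    refine Finset.sum_congr rfl fun k _ => ?_
    have hk : (C (((k + 1).factorial : L))⁻¹ : L⟦X⟧) * ((k + 1 : ℕ) : L⟦X⟧) =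
        C ((k.factorial : L))⁻¹ := by
      rw [← map_natCast (C (R := L)), ← map_mul]
      congr 1
      have : ((k + 1 : ℕ) : L) ≠ 0 := Nat.cast_ne_zero.2 k.succ_ne_zero
      rw [Nat.factorial_succ, Nat.cast_mul, mul_inv]
      field_simp
    rw [Derivation.leibniz, derivative_pow, derivative_C, ← hk]
    simp only [smul_eq_mul, Nat.add_sub_cancel]
    ring
  ext m
  rw [coeff_derivative, coeff_expS_of_le hf le_rfl, ← coeff_derivative, hsum, coeff_mul, coeff_mul]
  refine Finset.sum_congr rfl fun p hp => ?_
  have := Finset.HasAntidiagonal.mem_antidiagonal.1 hp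
  rw [coeff_expS_of_le hf (show p.2 ≤ m by omega)]

/-- The Lambert equation `w · exp (w - a) = a · exp (c x)` is equivalent to the differential
equation `w' = c w / (1 + w)`. -/
theorem mul_expS_sub_eq_iff {a c : L} (ha : 1 + a ≠ 0) {w : L⟦X⟧} (hw : constantCoeff w = a) :
    w * expS (w - C a) = C a * expS (C c * X) ↔ derivative L w = C c * w * (1 + w)⁻¹ := by
  have hE : constantCoeff (w - C a) = 0 := by simp [hw]
  have hinv : (1 + w) * (1 + w)⁻¹ = 1 := PowerSeries.mul_inv_cancel _ (by simpa [hw] using ha)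
  have hleft : derivative L (w * expS (w - C a)) =
      (1 + w) * derivative L w * expS (w - C a) := by
    rw [Derivation.leibniz, derivative_expS hE, map_sub, derivative_C]
    simp only [smul_eq_mul]
    ring
  have hright : derivative L (C a * expS (C c * X)) = C c * (C a * expS (C c * X)) := by
    rw [Derivation.leibniz, derivative_expS (by simp), Derivation.leibniz, derivative_C,
      derivative_C, derivative_X]
    simp only [smul_eq_mul]
    ring
  constructor
  · intro h
    have hne : expS (w - C a) ≠ 0 := fun h0 => by
      simpa [h0] using constantCoeff_expS (w - C a)
    rw [← h, hleft] at hright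
    have hode : (1 + w) * derivative L w = C c * w :=
      mul_right_cancel₀ hne (by rw [hright]; ring)
    linear_combination (1 + w)⁻¹ * hode - derivative L w * hinv
  · intro h
    refine (nonexpansive_C_mul c).eq_of_derivative_eq ?_ ?_ hright
    · simp [hw, constantCoeff_expS]
    · rw [hleft, h]
      linear_combination C c * w * expS (w - C a) * hinv

theorem coeff_of_one_add_mul_derivative_eq {a c : L} (ha : 1 + a ≠ 0) {w : L⟦X⟧}
    (hw : constantCoeff w = a) (h : (1 + w) * derivative L w = C c * w) :
    coeff 1 w = c * a / (1 + a) ∧ coeff 2 w = c ^ 2 * a / (2 * (1 + a) ^ 3) ∧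
      coeff 3 w = c ^ 3 * a * (1 - 2 * a) / (6 * (1 + a) ^ 5) := by
  have e0 := congrArg (coeff 0) h
  have e1 := congrArg (coeff 1) h
  have e2 := congrArg (coeff 2) h
  simp only [add_mul, one_mul, map_add, coeff_mul, coeff_derivative,
    Finset.Nat.antidiagonal_succ, Finset.Nat.antidiagonal_zero, Finset.map_singleton,
    Finset.sum_cons, Finset.map_cons, Finset.sum_singleton, Function.Embedding.prodMap,
    Function.Embedding.coeFn_mk, Prod.map, Function.Embedding.refl_apply,
    coeff_zero_eq_constantCoeff, hw] at e0 e1 e2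
  norm_num at e0 e1 e2
  have h1 : coeff 1 w = c * a / (1 + a) := by
    rw [eq_div_iff ha]
    linear_combination e0
  have h2 : coeff 2 w = c ^ 2 * a / (2 * (1 + a) ^ 3) := by
    rw [h1] at e1
    apply mul_left_cancel₀ (mul_ne_zero two_ne_zero ha)
    field_simp at e1 ⊢
    linear_combination e1
  refine ⟨h1, h2, ?_⟩
  rw [h1, h2] at e2
  apply mul_left_cancel₀ (mul_ne_zero three_ne_zero ha)
  field_simp at e2 ⊢
  linear_combination e2

end PowerSeries

theorem θv_ne_zero : θv ≠ 0 := by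
  rw [θv, Ne, FaithfulSMul.algebraMap_eq_zero_iff]
  exact MvPolynomial.X_ne_zero 0

theorem one_add_yv_ne_zero : 1 + yv ≠ 0 := by
  rw [yv, ← map_one (algebraMap (MvPolynomial (Fin 2) ℚ) K₅), ← map_add, Ne,
    FaithfulSMul.algebraMap_eq_zero_iff]
  intro h
  simpa using congrArg (MvPolynomial.eval 0) h

open PowerSeries in
/-- There is a unique `w ∈ K[[x]]` with constant term `y` satisfying
`w · exp(w − y) = y · exp(−x/θ)`, and its expansion begins
`w = y − xy/(θ(y+1)) + x²y/(2θ²(y+1)³) + x³y(2y−1)/(6θ³(y+1)⁵) + O(x⁴)`. -/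
theorem lambert_solution :
    ∃ w : PowerSeries K₅,
      (constantCoeff w = yv ∧
        w * expS (w - C yv) = C yv * expS (C (-θv⁻¹) * X) ∧
        coeff 0 w = yv ∧
        coeff 1 w = -(yv / (θv * (yv + 1))) ∧
        coeff 2 w = yv / (2 * θv ^ 2 * (yv + 1) ^ 3) ∧
        coeff 3 w = yv * (2 * yv - 1) / (6 * θv ^ 3 * (yv + 1) ^ 5)) ∧
      ∀ w' : PowerSeries K₅,
        constantCoeff w' = yv →
        w' * expS (w' - C yv) = C yv * expS (C (-θv⁻¹) * X) →
        w' = w := by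
  have hy := one_add_yv_ne_zero
  have hθ := θv_ne_zero
  obtain ⟨w, hw, hode⟩ := (nonexpansive_lambert (-θv⁻¹)).exists_derivative_eq yv
  have hinv : (1 + w) * (1 + w)⁻¹ = 1 := PowerSeries.mul_inv_cancel _ (by simpa [hw] using hy)
  obtain ⟨h1, h2, h3⟩ := coeff_of_one_add_mul_derivative_eq (c := -θv⁻¹) hy hw (by
    rw [hode]
    linear_combination C (-θv⁻¹) * w * hinv)
  have hy' : yv + 1 ≠ 0 := by rwa [add_comm]
  refine ⟨w, ⟨hw, (mul_expS_sub_eq_iff hy hw).2 hode, by simpa using hw, ?_, ?_, ?_⟩, ?_⟩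
  · rw [h1, add_comm 1 yv]
    field_simp
  · rw [h2, add_comm 1 yv]
    field_simp
  · rw [h3, add_comm 1 yv]
    field_simp
    ring
  · intro w' hw' h
    exact (nonexpansive_lambert (-θv⁻¹)).eq_of_derivative_eq (hw'.trans hw.symm)
      ((mul_expS_sub_eq_iff hy hw').1 h) hode

end
end

section
/- Let λ be a Young diagram, i.e., a finite subset of ℕ × ℕ such that whenever (i, j) ∈ λ and i′ ≤ i, j′ ≤ j then (i′, j′) ∈ λ. Define the Laurent polynomial F(x) = Σ_{(i,j)∈λ} x^{i−j} ∈ ℤ[x, x^{−1}]. Then the constant term (coefficient of x⁰) of the Laurent polynomial −F(x) − F(x^{−1}) + F(x)·F(x^{−1})·(2 − x − x^{−1}) is equal to zero. -/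
/-!
STATEMENT 7: for a Young diagram `λ` and `F(x) = Σ_{(i,j)∈λ} x^{i−j}`, the
Laurent polynomial `−F(x) − F(x⁻¹) + F(x)·F(x⁻¹)·(2 − x − x⁻¹)` has zero
constant term.
-/

open LaurentPolynomial

/-- The number of cells of `lam` on the diagonal of content `k`. -/
def diagCard (lam : Finset (ℕ × ℕ)) (k : ℤ) : ℕ :=
  (lam.filter fun p => (p.1 : ℤ) - p.2 = k).card

lemma diagCard_map_swap (lam : Finset (ℕ × ℕ)) (k : ℤ) :
    diagCard (lam.map (Equiv.prodComm ℕ ℕ).toEmbedding) k = diagCard lam (-k) := by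
  unfold diagCard
  rw [Finset.filter_map, Finset.card_map]
  congr 1
  ext p
  simp only [Finset.mem_filter, Function.comp_apply, Equiv.coe_toEmbedding,
    Equiv.prodComm_apply, Prod.fst_swap, Prod.snd_swap]
  refine and_congr_right fun _ => ?_
  omega

lemma diagCard_succ_le {lam : Finset (ℕ × ℕ)}
    (hlow : ∀ i j i' j' : ℕ, (i, j) ∈ lam → i' ≤ i → j' ≤ j → (i', j') ∈ lam) (k : ℕ) :
    diagCard lam (k + 1) ≤ diagCard lam k := by
  refine Finset.card_le_card_of_injOn (fun p => (p.1 - 1, p.2)) ?_ ?_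
  · rintro ⟨i, j⟩ h
    simp only [Finset.coe_filter, Set.mem_ofPred_eq] at h ⊢
    exact ⟨hlow i j _ _ h.1 (by omega) le_rfl, by omega⟩
  · rintro ⟨i, j⟩ h ⟨i', j'⟩ h' he
    simp only [Finset.coe_filter, Set.mem_ofPred_eq, Prod.mk.injEq] at h h' he ⊢
    omega

lemma diagCard_le_succ_add_one {lam : Finset (ℕ × ℕ)}
    (hlow : ∀ i j i' j' : ℕ, (i, j) ∈ lam → i' ≤ i → j' ≤ j → (i', j') ∈ lam) (k : ℕ) :
    diagCard lam k ≤ diagCard lam (k + 1) + 1 := by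
  rw [← Nat.sub_le_iff_le_add]
  refine (Finset.pred_card_le_card_erase (a := (k, 0))).trans ?_
  refine Finset.card_le_card_of_injOn (fun p => (p.1, p.2 - 1)) ?_ ?_
  · rintro ⟨i, j⟩ h
    simp only [Finset.coe_erase, Finset.coe_filter, Set.mem_sdiff, Set.mem_ofPred_eq,
      Set.mem_singleton_iff, Prod.mk.injEq] at h ⊢
    exact ⟨hlow i j _ _ h.1.1 le_rfl (by omega), by omega⟩
  · rintro ⟨i, j⟩ h ⟨i', j'⟩ h' he
    simp only [Finset.coe_erase, Finset.coe_filter, Set.mem_sdiff, Set.mem_ofPred_eq,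
      Set.mem_singleton_iff, Prod.mk.injEq] at h h' he ⊢
    omega

lemma sq_diagCard_sub {lam : Finset (ℕ × ℕ)}
    (hlow : ∀ i j i' j' : ℕ, (i, j) ∈ lam → i' ≤ i → j' ≤ j → (i', j') ∈ lam) (k : ℕ) :
    ((diagCard lam k : ℤ) - diagCard lam (k + 1)) ^ 2 =
      diagCard lam k - diagCard lam (k + 1) := by
  have h₁ := diagCard_succ_le hlow k
  have h₂ := diagCard_le_succ_add_one hlow k
  obtain h | h : diagCard lam k = diagCard lam (k + 1) ∨
    diagCard lam k = diagCard lam (k + 1) + 1 := by omega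
  all_goals rw [h]; push_cast; ring

/-- Summation by parts for a sequence whose steps away from `0` go down by `0` or `1`. -/
lemma sum_mul_second_difference (c : ℤ → ℤ)
    (hpos : ∀ k : ℕ, (c k - c (k + 1)) ^ 2 = c k - c (k + 1))
    (hneg : ∀ k : ℕ, (c (-k) - c (-(k + 1))) ^ 2 = c (-k) - c (-(k + 1))) (n : ℕ) :
    ∑ k ∈ Finset.Icc (-n : ℤ) n, c k * (2 * c k - c (k + 1) - c (k - 1)) =
      2 * c 0 - c n - c (-n) + c n * (c n - c (n + 1)) + c (-n) * (c (-n) - c (-(n + 1))) := by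
  induction n with
  | zero => simp; ring
  | succ n ih =>
    have hI : Finset.Icc (-(n + 1 : ℕ) : ℤ) (n + 1 : ℕ) =
        insert (-(n + 1) : ℤ) (insert (n + 1 : ℤ) (Finset.Icc (-n : ℤ) n)) := by
      ext x
      simp only [Finset.mem_insert, Finset.mem_Icc]
      omega
    rw [hI, Finset.sum_insert (by simp only [Finset.mem_insert, Finset.mem_Icc]; omega),
      Finset.sum_insert (by simp only [Finset.mem_Icc]; omega), ih]
    have e₁ : (-(n + 1) + 1 : ℤ) = -n := by ring
    have e₂ : (-(n + 1) - 1 : ℤ) = -(n + 1 + 1) := by ring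
    have e₃ : (n + 1 - 1 : ℤ) = n := by ring
    push_cast
    rw [e₁, e₂, e₃]
    linear_combination hpos n + hneg n

lemma sum_diagCard {lam : Finset (ℕ × ℕ)}
    (hlow : ∀ i j i' j' : ℕ, (i, j) ∈ lam → i' ≤ i → j' ≤ j → (i', j') ∈ lam) :
    ∑ p ∈ lam, (2 * (diagCard lam (p.1 - p.2) : ℤ) - diagCard lam (p.1 - p.2 + 1)
      - diagCard lam (p.1 - p.2 - 1)) = 2 * diagCard lam 0 := by
  obtain ⟨n, hn⟩ : ∃ n : ℕ, ∀ p ∈ lam, p.1 + p.2 < n :=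
    ⟨lam.sup (fun p => p.1 + p.2) + 1, fun p hp =>
      Nat.lt_succ_of_le (Finset.le_sup (f := fun p : ℕ × ℕ => p.1 + p.2) hp)⟩
  have hzero : ∀ k : ℤ, k = n ∨ k = -n → diagCard lam k = 0 := by
    intro k hk
    rw [diagCard, Finset.card_eq_zero, Finset.filter_eq_empty_iff]
    intro p hp h
    have := hn p hp
    omega
  have hneg : ∀ k : ℕ, ((diagCard lam (-k) : ℤ) - diagCard lam (-(k + 1))) ^ 2 =
      diagCard lam (-k) - diagCard lam (-(k + 1)) := by
    intro k
    simp only [← diagCard_map_swap]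
    refine sq_diagCard_sub ?_ k
    intro i j i' j' h hi hj
    simp only [Finset.mem_map_equiv, Equiv.prodComm_symm, Equiv.prodComm_apply,
      Prod.swap_prod_mk] at h ⊢
    exact hlow _ _ _ _ h hj hi
  have key := sum_mul_second_difference (fun k => (diagCard lam k : ℤ))
    (sq_diagCard_sub hlow) hneg n
  simp only [hzero n (Or.inl rfl), hzero (-n) (Or.inr rfl)] at key
  rw [← Finset.sum_fiberwise_of_maps_to (t := Finset.Icc (-n : ℤ) n)
    (g := fun p : ℕ × ℕ => (p.1 : ℤ) - p.2)]
  · trans ∑ k ∈ Finset.Icc (-n : ℤ) n, (diagCard lam k : ℤ) *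
      (2 * diagCard lam k - diagCard lam (k + 1) - diagCard lam (k - 1))
    · refine Finset.sum_congr rfl fun k _ => ?_
      rw [Finset.sum_congr rfl (g := fun _ => (2 * (diagCard lam k : ℤ)
        - diagCard lam (k + 1) - diagCard lam (k - 1)))]
      · rw [Finset.sum_const, nsmul_eq_mul]
        rfl
      · intro p hp
        rw [(Finset.mem_filter.1 hp).2]
    · rw [key]
      simp
  · intro p hp
    have := hn p hp
    rw [Finset.mem_Icc]
    omega

lemma coeff_sum_T (lam : Finset (ℕ × ℕ)) (f : ℕ × ℕ → ℤ) (k m : ℤ)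
    (h : ∀ p, f p = m ↔ (p.1 : ℤ) - p.2 = k) :
    (∑ p ∈ lam, (T (f p) : LaurentPolynomial ℤ)).coeff m = diagCard lam k := by
  simp [AddMonoidAlgebra.coeff_sum, Finsupp.finsetSum_apply, h, diagCard]

theorem tangent_weights_no_constant_term (lam : Finset (ℕ × ℕ))
    (hlow : ∀ i j i' j' : ℕ, (i, j) ∈ lam → i' ≤ i → j' ≤ j → (i', j') ∈ lam) :
    ((- (∑ p ∈ lam, (T ((p.1 : ℤ) - p.2) : LaurentPolynomial ℤ))
        - (∑ p ∈ lam, (T ((p.2 : ℤ) - p.1) : LaurentPolynomial ℤ))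
        + (∑ p ∈ lam, (T ((p.1 : ℤ) - p.2) : LaurentPolynomial ℤ))
            * (∑ p ∈ lam, (T ((p.2 : ℤ) - p.1) : LaurentPolynomial ℤ))
            * (2 - T 1 - T (-1))) : LaurentPolynomial ℤ).coeff 0 = 0 := by
  have hprod : (∑ p ∈ lam, (T ((p.1 : ℤ) - p.2) : LaurentPolynomial ℤ))
      * (∑ p ∈ lam, (T ((p.2 : ℤ) - p.1) : LaurentPolynomial ℤ)) * (2 - T 1 - T (-1)) =
      ∑ p ∈ lam, ((∑ q ∈ lam, T ((p.1 : ℤ) - p.2 + (q.2 - q.1)))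
        + (∑ q ∈ lam, T ((p.1 : ℤ) - p.2 + (q.2 - q.1)))
        - (∑ q ∈ lam, T ((p.1 : ℤ) - p.2 + (q.2 - q.1) + 1))
        - (∑ q ∈ lam, T ((p.1 : ℤ) - p.2 + (q.2 - q.1) + -1))) := by
    simp only [T_add _ (1 : ℤ), T_add _ (-1 : ℤ), T_add _ (_ - _), ← Finset.sum_mul,
      ← Finset.mul_sum, Finset.sum_sub_distrib, Finset.sum_add_distrib]
    ring
  have hcoeff (p : ℕ × ℕ) : ((∑ q ∈ lam, T ((p.1 : ℤ) - p.2 + (q.2 - q.1)))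
        + (∑ q ∈ lam, T ((p.1 : ℤ) - p.2 + (q.2 - q.1)))
        - (∑ q ∈ lam, T ((p.1 : ℤ) - p.2 + (q.2 - q.1) + 1))
        - (∑ q ∈ lam, T ((p.1 : ℤ) - p.2 + (q.2 - q.1) + -1)) : LaurentPolynomial ℤ).coeff 0 =
      2 * (diagCard lam (p.1 - p.2) : ℤ) - diagCard lam (p.1 - p.2 + 1)
        - diagCard lam (p.1 - p.2 - 1) := by
    simp only [AddMonoidAlgebra.coeff_sub, AddMonoidAlgebra.coeff_add, Finsupp.sub_apply,
      Finsupp.add_apply]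
    rw [coeff_sum_T lam _ (p.1 - p.2) 0 (fun q => by omega),
      coeff_sum_T lam _ (p.1 - p.2 + 1) 0 (fun q => by omega),
      coeff_sum_T lam _ (p.1 - p.2 - 1) 0 (fun q => by omega)]
    ring
  rw [hprod]
  simp only [AddMonoidAlgebra.coeff_add (_ - _), AddMonoidAlgebra.coeff_sub (-_),
    AddMonoidAlgebra.coeff_neg, Finsupp.sub_apply,
    Finsupp.add_apply, Finsupp.neg_apply]
  rw [coeff_sum_T lam _ 0 0 (fun q => by omega), coeff_sum_T lam _ 0 0 (fun q => by omega),
    AddMonoidAlgebra.coeff_sum, Finsupp.finsetSum_apply, Finset.sum_congr rfl fun p _ => hcoeff p,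
    sum_diagCard hlow]
  ring
end
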